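/- arXiv:1610.08897 — 2 statements merged into one kernel-verified Lean document; each statement's English description precedes it below -/
import Mathlib

section
/- There exists a constant C < ∞ such that for every ω₁ ∈ ℤ³, ∑_{ω₂ ∈ ℤ³} ⟨ω₂⟩^{-2} ( ⟨ω₂⟩ + ⟨ω₁ + ω₂⟩ )^{-2} ≤ C ⟨ω₁⟩^{-1}. -/
open scoped BigOperators

/-- The Japanese bracket `⟨ω⟩ = (1 + 4π²|ω|²)^{1/2}` of `ω ∈ ℤ³`. -/
noncomputable def jap (ω : Fin 3 → ℤ) : ℝ :=
  Real.sqrt (1 + 4 * Real.pi ^ 2 * ∑ i, ((ω i : ℝ)) ^ 2)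

lemma one_le_jap (ω : Fin 3 → ℤ) : 1 ≤ jap ω := by
  rw [jap, Real.one_le_sqrt]
  have : 0 ≤ ∑ i, ((ω i : ℝ)) ^ 2 := Finset.sum_nonneg fun i _ => sq_nonneg _
  nlinarith [mul_nonneg (sq_nonneg Real.pi) this]

lemma jap_sq (ω : Fin 3 → ℤ) :
    jap ω ^ 2 = 1 + 4 * Real.pi ^ 2 * ∑ i, ((ω i : ℝ)) ^ 2 := by
  have : 0 ≤ ∑ i, ((ω i : ℝ)) ^ 2 := Finset.sum_nonneg fun i _ => sq_nonneg _
  exact Real.sq_sqrt (by positivity)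

lemma natAbs_succ_le_jap (ω : Fin 3 → ℤ) (i : Fin 3) :
    ((ω i).natAbs : ℝ) + 1 ≤ jap ω := by
  refine le_of_sq_le_sq ?_ (by linarith [one_le_jap ω])
  rw [jap_sq]
  have h1 : ((ω i : ℝ)) ^ 2 ≤ ∑ j, ((ω j : ℝ)) ^ 2 :=
    Finset.single_le_sum (f := fun j => ((ω j : ℝ)) ^ 2) (fun j _ => sq_nonneg _)
      (Finset.mem_univ i)
  have h2 : ((ω i : ℝ)) ^ 2 = ((ω i).natAbs : ℝ) ^ 2 := by
    rw [Nat.cast_natAbs, Int.cast_abs, sq_abs]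
  have h3 : ((ω i).natAbs : ℝ) ≤ ((ω i).natAbs : ℝ) ^ 2 := by
    exact_mod_cast Nat.le_self_pow two_ne_zero _
  have h4 : 3 ≤ Real.pi ^ 2 := by nlinarith [Real.pi_gt_three]
  rw [h2] at h1
  nlinarith

lemma jap_le_two_mul_add (ω₁ ω₂ : Fin 3 → ℤ) :
    jap ω₁ ≤ 2 * (jap ω₂ + jap (ω₁ + ω₂)) := by
  have h1 := one_le_jap ω₂
  have h2 := one_le_jap (ω₁ + ω₂)
  refine le_of_sq_le_sq ?_ (by linarith)
  have h : jap ω₁ ^ 2 ≤ 2 * (jap ω₂ ^ 2 + jap (ω₁ + ω₂) ^ 2) := by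
    have key : ∑ i, ((ω₁ i : ℝ)) ^ 2 ≤
        2 * (∑ i, ((ω₂ i : ℝ)) ^ 2 + ∑ i, (((ω₁ + ω₂) i : ℤ) : ℝ) ^ 2) := by
      rw [← Finset.sum_add_distrib, Finset.mul_sum]
      refine Finset.sum_le_sum fun i _ => ?_
      push_cast [Pi.add_apply]
      nlinarith [sq_nonneg ((ω₁ i : ℝ) + 2 * ω₂ i)]
    simp only [jap_sq]
    nlinarith [mul_le_mul_of_nonneg_left key (sq_nonneg Real.pi)]
  nlinarith [mul_nonneg (zero_le_one.trans h1) (zero_le_one.trans h2)]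

/-- The real cube root of a nonnegative number. -/
noncomputable def cubeRoot (x : ℝ) : ℝ := x ^ (1 / 3 : ℝ)

lemma cubeRoot_pow {x : ℝ} (hx : 0 ≤ x) : cubeRoot x ^ 3 = x := by
  rw [cubeRoot, ← Real.rpow_natCast, ← Real.rpow_mul hx]
  norm_num

lemma cubeRoot_mono {x y : ℝ} (hx : 0 ≤ x) (h : x ≤ y) : cubeRoot x ≤ cubeRoot y :=
  Real.rpow_le_rpow hx h (by norm_num)

lemma one_le_cubeRoot {x : ℝ} (hx : 1 ≤ x) : 1 ≤ cubeRoot x :=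
  Real.one_le_rpow hx (by norm_num)

/-- The one-dimensional weight `(n+1)^{-2/3} ((n+1)^{1/3} + K)^{-2}`. -/
noncomputable def weight (K : ℝ) (n : ℕ) : ℝ :=
  1 / (cubeRoot (n + 1) ^ 2 * (cubeRoot (n + 1) + K) ^ 2)

lemma weight_nonneg (K : ℝ) (n : ℕ) : 0 ≤ weight K n := by
  unfold weight; positivity

lemma inv_sq_mul_sq_le_sub {u v K : ℝ} (hu : 1 ≤ u) (hv : 1 ≤ v) (hK : 0 < K)
    (h : v ^ 3 = u ^ 3 + 1) :
    1 / (u ^ 2 * (u + K) ^ 2) ≤ 24 * (1 / (u + K) - 1 / (v + K)) := by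
  have hu3 : 1 ≤ u ^ 3 := one_le_pow₀ hu
  have huv : u ≤ v := le_of_pow_le_pow_left₀ three_ne_zero (by linarith) (by linarith)
  have hv2 : v ≤ 2 * u :=
    le_of_pow_le_pow_left₀ three_ne_zero (by linarith) (by rw [mul_pow]; linarith)
  have hq : 0 < v ^ 2 + u * v + u ^ 2 := by positivity
  have hd : v - u = 1 / (v ^ 2 + u * v + u ^ 2) := by
    rw [eq_div_iff hq.ne']; linear_combination h
  have h1 : v ^ 2 + u * v + u ^ 2 ≤ 12 * u ^ 2 := by nlinarith
  have e : 24 * (1 / (u + K) - 1 / (v + K)) =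
      24 / ((v ^ 2 + u * v + u ^ 2) * ((u + K) * (v + K))) := by
    have : 1 / (u + K) - 1 / (v + K) = (v - u) / ((u + K) * (v + K)) := by
      field_simp; ring
    rw [this, hd]; field_simp
  rw [e, div_le_div_iff₀ (by positivity) (by positivity)]
  have h2 : (u + K) * (v + K) ≤ 2 * (u + K) ^ 2 := by nlinarith
  have := mul_le_mul h1 h2 (by positivity) (by positivity)
  linarith

lemma sum_range_weight_le {K : ℝ} (hK : 0 < K) (N : ℕ) :
    ∑ n ∈ Finset.range N, weight K n ≤ 24 / K := by
  have hc (n : ℕ) : 1 ≤ cubeRoot (n + 1) :=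
    one_le_cubeRoot (by linarith [Nat.cast_nonneg (α := ℝ) n])
  let g (n : ℕ) : ℝ := 1 / (cubeRoot (n + 1) + K)
  have hle : ∑ n ∈ Finset.range N, weight K n ≤
      ∑ n ∈ Finset.range N, 24 * (g n - g (n + 1)) := by
    refine Finset.sum_le_sum fun n _ => inv_sq_mul_sq_le_sub (hc n) (hc (n + 1)) hK ?_
    rw [cubeRoot_pow (by positivity), cubeRoot_pow (by positivity)]
    push_cast; ring
  rw [← Finset.mul_sum, Finset.sum_range_sub'] at hle
  have h0 : g 0 ≤ 1 / K := one_div_le_one_div_of_le hK (by linarith [hc 0])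
  have hN : 0 ≤ g N := one_div_nonneg.2 (by linarith [hc N])
  have : 24 / K = 24 * (1 / K) := by ring
  linarith

lemma sum_weight_natAbs_le {K : ℝ} (hK : 0 < K) (T : Finset ℤ) :
    ∑ k ∈ T, weight K k.natAbs ≤ 48 / K := by
  rw [Finset.sum_comp (weight K) Int.natAbs]
  obtain ⟨N, hN⟩ := Finset.exists_nat_subset_range (T.image Int.natAbs)
  have hcard (n : ℕ) : (T.filter fun k => k.natAbs = n).card ≤ 2 := by
    refine (Finset.card_le_card (t := {(n : ℤ), -(n : ℤ)}) fun k hk => ?_).trans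
      Finset.card_le_two
    have := (Finset.mem_filter.1 hk).2
    simp only [Finset.mem_insert, Finset.mem_singleton]
    omega
  calc _ ≤ ∑ n ∈ T.image Int.natAbs, 2 * weight K n := by
        refine Finset.sum_le_sum fun n _ => ?_
        rw [nsmul_eq_mul]
        exact mul_le_mul_of_nonneg_right (by exact_mod_cast hcard n) (weight_nonneg K n)
    _ ≤ ∑ n ∈ Finset.range N, 2 * weight K n :=
        Finset.sum_le_sum_of_subset_of_nonneg hN fun n _ _ =>
          mul_nonneg zero_le_two (weight_nonneg K n)
    _ ≤ 2 * (24 / K) := by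
        rw [← Finset.mul_sum]
        exact mul_le_mul_of_nonneg_left (sum_range_weight_le hK N) zero_le_two
    _ = 48 / K := by ring

lemma sum_prod_weight_le {K : ℝ} (hK : 0 < K) (s : Finset (Fin 3 → ℤ)) :
    ∑ ω ∈ s, ∏ i, weight K (ω i).natAbs ≤ (48 / K) ^ 3 := by
  have hsub : s ⊆ Fintype.piFinset fun i => s.image (· i) := fun ω hω =>
    Fintype.mem_piFinset.2 fun i => Finset.mem_image_of_mem _ hω
  calc _ ≤ ∑ ω ∈ Fintype.piFinset fun i => s.image (· i), ∏ i, weight K (ω i).natAbs :=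
        Finset.sum_le_sum_of_subset_of_nonneg hsub fun ω _ _ =>
          Finset.prod_nonneg fun i _ => weight_nonneg K _
    _ = ∏ i, ∑ k ∈ s.image (· i), weight K k.natAbs := by
        rw [Finset.prod_univ_sum]
    _ ≤ ∏ _i : Fin 3, 48 / K :=
        Finset.prod_le_prod (fun i _ => Finset.sum_nonneg fun k _ => weight_nonneg K _)
          fun i _ => sum_weight_natAbs_le hK _
    _ = (48 / K) ^ 3 := by rw [Finset.prod_const, Finset.card_univ, Fintype.card_fin]

lemma summand_le_prod_weight (ω₁ ω₂ : Fin 3 → ℤ) :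
    1 / (jap ω₂ ^ 2 * (jap ω₂ + jap (ω₁ + ω₂)) ^ 2) ≤
      729 * ∏ i, weight (cubeRoot (jap ω₁)) (ω₂ i).natAbs := by
  have ha := one_le_jap ω₂
  have hb := one_le_jap (ω₁ + ω₂)
  have hJ := one_le_jap ω₁
  set a := jap ω₂
  set S := a + jap (ω₁ + ω₂) with hS
  have hS0 : 0 ≤ S := by linarith
  have hK := one_le_cubeRoot hJ
  set K := cubeRoot (jap ω₁)
  have hA := one_le_cubeRoot ha
  have hR : 1 ≤ cubeRoot S := one_le_cubeRoot (by linarith)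
  have hKS : K ≤ 2 * cubeRoot S := by
    refine le_of_pow_le_pow_left₀ three_ne_zero (by linarith) ?_
    rw [mul_pow, cubeRoot_pow hS0, cubeRoot_pow (by linarith)]
    linarith [jap_le_two_mul_add ω₁ ω₂]
  have hw (i : Fin 3) :
      1 / (cubeRoot a ^ 2 * (3 * cubeRoot S) ^ 2) ≤ weight K (ω₂ i).natAbs := by
    have h1 : 1 ≤ cubeRoot (((ω₂ i).natAbs : ℝ) + 1) := one_le_cubeRoot (by simp)
    have h2 : cubeRoot (((ω₂ i).natAbs : ℝ) + 1) ≤ cubeRoot a :=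
      cubeRoot_mono (by positivity) (natAbs_succ_le_jap ω₂ i)
    have h3 : cubeRoot a ≤ cubeRoot S := cubeRoot_mono (by linarith) (by linarith)
    unfold weight
    refine one_div_le_one_div_of_le (by positivity) ?_
    gcongr
    linarith
  calc 1 / (a ^ 2 * S ^ 2)
      = 729 * ∏ _i : Fin 3, 1 / (cubeRoot a ^ 2 * (3 * cubeRoot S) ^ 2) := by
        rw [Finset.prod_const, Finset.card_univ, Fintype.card_fin]
        nth_rewrite 1 [← cubeRoot_pow (zero_le_one.trans ha), ← cubeRoot_pow hS0]
        field_simp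
        norm_num
    _ ≤ _ := by
        gcongr with i
        exact hw i

/-- The key sum bound in the second Wiener chaos estimate for the diagram ⟨22⟩:
`∑_{ω₂ ∈ ℤ³} ⟨ω₂⟩⁻² (⟨ω₂⟩ + ⟨ω₁+ω₂⟩)⁻² ≤ C ⟨ω₁⟩⁻¹`. -/
theorem sum_bound_second_chaos_22 :
    ∃ C : ℝ, ∀ ω₁ : Fin 3 → ℤ,
      ∑' ω₂ : Fin 3 → ℤ, 1 / (jap ω₂ ^ 2 * (jap ω₂ + jap (ω₁ + ω₂)) ^ 2)
        ≤ C / jap ω₁ := by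
  refine ⟨729 * 48 ^ 3, fun ω₁ => Real.tsum_le_of_sum_le (fun ω₂ => by positivity) fun s => ?_⟩
  have hJ := one_le_jap ω₁
  calc _ ≤ ∑ ω₂ ∈ s, 729 * ∏ i, weight (cubeRoot (jap ω₁)) (ω₂ i).natAbs :=
        Finset.sum_le_sum fun ω₂ _ => summand_le_prod_weight ω₁ ω₂
    _ ≤ 729 * (48 / cubeRoot (jap ω₁)) ^ 3 := by
        rw [← Finset.mul_sum]
        exact mul_le_mul_of_nonneg_left
          (sum_prod_weight_le (by linarith [one_le_cubeRoot hJ]) s) (by norm_num)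
    _ = 729 * 48 ^ 3 / jap ω₁ := by
        rw [div_pow, cubeRoot_pow (by linarith), mul_div_assoc]
end

section
/- For every constant c ∈ (0, 1) there exists C < ∞ such that for every ω ∈ ℤ³, ∑ ( ⟨ω₁⟩ ⟨ω₂⟩ ⟨ω₂'⟩ ⟨ω₃⟩ ( ⟨ω₂⟩ + ⟨ω₁ + ω₂⟩ ) ( ⟨ω₂'⟩ + ⟨ω₂' − ω₁⟩ ) )^{-2} ≤ C ⟨ω⟩^{-3}, where the sum ranges over all ω₁, ω₂, ω₂', ω₃ ∈ ℤ³ satisfying ω₁ + ω₃ = ω, |ω₁| ≥ c|ω| and |ω₃| ≥ c|ω|. -/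
open scoped BigOperators

/-- The Euclidean norm of `ω ∈ ℤ³`. -/
noncomputable def znorm (ω : Fin 3 → ℤ) : ℝ :=
  Real.sqrt (∑ i, ((ω i : ℝ)) ^ 2)

open scoped ENNReal

/-- The sup norm of `x ∈ ℤ³`, as a natural number. -/
def supNorm (x : Fin 3 → ℤ) : ℕ := Finset.univ.sup fun i => (x i).natAbs

lemma supNorm_le_iff (x : Fin 3 → ℤ) (n : ℕ) : supNorm x ≤ n ↔ ∀ i, (x i).natAbs ≤ n := by
  simp [supNorm]

lemma natAbs_le_supNorm (x : Fin 3 → ℤ) (i : Fin 3) : (x i).natAbs ≤ supNorm x :=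
  (supNorm_le_iff x _).1 le_rfl i

lemma supNorm_sub_le (x y : Fin 3 → ℤ) : supNorm (x - y) ≤ supNorm x + supNorm y := by
  rw [supNorm_le_iff]
  intro i
  have hx := natAbs_le_supNorm x i
  have hy := natAbs_le_supNorm y i
  simp only [Pi.sub_apply]
  omega

lemma exists_supNorm_eq (x : Fin 3 → ℤ) : ∃ i, supNorm x = (x i).natAbs := by
  obtain ⟨i, -, hi⟩ := Finset.exists_mem_eq_sup Finset.univ Finset.univ_nonempty
    fun i => (x i).natAbs
  exact ⟨i, hi⟩

lemma sq_supNorm_le (x : Fin 3 → ℤ) : (supNorm x : ℝ) ^ 2 ≤ ∑ i, (x i : ℝ) ^ 2 := by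
  obtain ⟨i, hi⟩ := exists_supNorm_eq x
  rw [hi, Nat.cast_natAbs, Int.cast_abs, sq_abs]
  exact Finset.single_le_sum (f := fun i => (x i : ℝ) ^ 2) (fun _ _ => sq_nonneg _)
    (Finset.mem_univ i)

lemma sum_sq_le (x : Fin 3 → ℤ) : ∑ i, (x i : ℝ) ^ 2 ≤ 3 * (supNorm x : ℝ) ^ 2 := by
  have h : ∀ i, (x i : ℝ) ^ 2 ≤ (supNorm x : ℝ) ^ 2 := by
    intro i
    have h1 : ((x i).natAbs : ℝ) ≤ supNorm x := by exact_mod_cast natAbs_le_supNorm x i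
    rw [Nat.cast_natAbs, Int.cast_abs] at h1
    exact sq_le_sq' (abs_le.1 h1).1 (abs_le.1 h1).2
  calc ∑ i, (x i : ℝ) ^ 2 ≤ ∑ _i : Fin 3, (supNorm x : ℝ) ^ 2 := Finset.sum_le_sum fun i _ => h i
    _ = 3 * (supNorm x : ℝ) ^ 2 := by simp

lemma supNorm_add_one_le_jap (x : Fin 3 → ℤ) : (supNorm x : ℝ) + 1 ≤ jap x := by
  apply Real.le_sqrt_of_sq_le
  have h1 := sq_supNorm_le x
  have h2 : (supNorm x : ℝ) ≤ (supNorm x : ℝ) ^ 2 := by exact_mod_cast Nat.le_self_pow two_ne_zero _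
  have h3 : (9 : ℝ) ≤ Real.pi ^ 2 := by nlinarith [Real.pi_gt_three]
  have h4 : 9 * ∑ i, (x i : ℝ) ^ 2 ≤ Real.pi ^ 2 * ∑ i, (x i : ℝ) ^ 2 := by
    gcongr
  nlinarith

lemma jap_le (x : Fin 3 → ℤ) : jap x ≤ 14 * ((supNorm x : ℝ) + 1) := by
  apply Real.sqrt_le_iff.2 ⟨by positivity, _⟩
  have h1 := sum_sq_le x
  have h3 : Real.pi ^ 2 ≤ 16 := by nlinarith [Real.pi_gt_three, Real.pi_le_four]
  have h4 : Real.pi ^ 2 * ∑ i, (x i : ℝ) ^ 2 ≤ 16 * (3 * (supNorm x : ℝ) ^ 2) := by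
    gcongr
  have h5 : (0 : ℝ) ≤ supNorm x := Nat.cast_nonneg _
  nlinarith

lemma mul_jap_le {c : ℝ} (hc : c ∈ Set.Ioo (0 : ℝ) 1) {x y : Fin 3 → ℤ}
    (h : c * znorm x ≤ znorm y) : c * jap x ≤ jap y := by
  have hc0 : 0 < c := hc.1
  have hx : 0 ≤ ∑ i, (x i : ℝ) ^ 2 := by positivity
  have hy : 0 ≤ ∑ i, (y i : ℝ) ^ 2 := by positivity
  have h1 : (c * znorm x) ^ 2 ≤ znorm y ^ 2 :=
    pow_le_pow_left₀ (mul_nonneg hc0.le (Real.sqrt_nonneg _)) h 2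
  rw [mul_pow, znorm, znorm, Real.sq_sqrt hx, Real.sq_sqrt hy] at h1
  apply Real.le_sqrt_of_sq_le
  rw [mul_pow, jap, Real.sq_sqrt (by positivity)]
  have h2 := mul_le_mul_of_nonneg_left h1 (by positivity : 0 ≤ 4 * Real.pi ^ 2)
  have h3 : c ^ 2 ≤ 1 := pow_le_one₀ hc0.le hc.2.le
  linarith

lemma card_Icc_const (n : ℕ) :
    (Finset.Icc (fun _ : Fin 3 => -(n : ℤ)) fun _ => (n : ℤ)).card = (2 * n + 1) ^ 3 := by
  rw [Pi.card_Icc]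
  simp only [Int.card_Icc, Finset.prod_const, Finset.card_univ, Fintype.card_fin]
  congr 1
  omega

lemma mem_Icc_const (n : ℕ) (x : Fin 3 → ℤ) :
    x ∈ Finset.Icc (fun _ : Fin 3 => -(n : ℤ)) (fun _ => (n : ℤ)) ↔ supNorm x ≤ n := by
  rw [Finset.mem_Icc, supNorm_le_iff, Pi.le_def, Pi.le_def, ← forall_and]
  refine forall_congr' fun i => ?_
  omega

lemma exists_finset_sphere (n : ℕ) :
    ∃ s : Finset (Fin 3 → ℤ), s.card ≤ 26 * (n + 1) ^ 2 ∧ ∀ x, x ∈ s ↔ supNorm x = n := by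
  rcases n with _ | n
  · refine ⟨Finset.Icc (fun _ => -((0 : ℕ) : ℤ)) fun _ => ((0 : ℕ) : ℤ), ?_, fun x => ?_⟩
    · rw [card_Icc_const]; norm_num
    · rw [mem_Icc_const]; omega
  · refine ⟨Finset.Icc (fun _ => -((n + 1 : ℕ) : ℤ)) (fun _ => ((n + 1 : ℕ) : ℤ)) \
      Finset.Icc (fun _ => -(n : ℤ)) (fun _ => (n : ℤ)), ?_, fun x => ?_⟩
    · rw [Finset.card_sdiff_of_subset, card_Icc_const, card_Icc_const]
      · rw [Nat.sub_le_iff_le_add]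
        have e : 26 * (n + 1 + 1) ^ 2 + (2 * n + 1) ^ 3 =
            (2 * (n + 1) + 1) ^ 3 + (2 * n ^ 2 + 56 * n + 78) := by ring
        rw [e]
        exact Nat.le_add_right _ _
      · intro x
        rw [mem_Icc_const, mem_Icc_const]
        omega
    · rw [Finset.mem_sdiff, mem_Icc_const, mem_Icc_const]
      omega

/-- Summation of a radial function on `ℤ³` over the spheres of the sup norm. -/
lemma tsum_radial_le (g : ℕ → ℝ≥0∞) :
    ∑' x : Fin 3 → ℤ, g (supNorm x) ≤ 26 * ∑' n : ℕ, ((n : ℝ≥0∞) + 1) ^ 2 * g n := by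
  calc ∑' x : Fin 3 → ℤ, g (supNorm x)
      = ∑' x : Fin 3 → ℤ, ∑' n : ℕ, if supNorm x = n then g n else 0 := by simp
    _ = ∑' n : ℕ, ∑' x : Fin 3 → ℤ, if supNorm x = n then g n else 0 := ENNReal.tsum_comm
    _ ≤ ∑' n : ℕ, 26 * (((n : ℝ≥0∞) + 1) ^ 2 * g n) := by
        refine ENNReal.tsum_le_tsum fun n => ?_
        obtain ⟨s, hs, hmem⟩ := exists_finset_sphere n
        rw [tsum_eq_sum (s := s) fun x hx => if_neg fun h => hx ((hmem x).2 h)]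
        rw [Finset.sum_congr rfl fun x hx => if_pos ((hmem x).1 hx), Finset.sum_const,
          nsmul_eq_mul, ← mul_assoc]
        gcongr
        exact_mod_cast hs
    _ = 26 * ∑' n : ℕ, ((n : ℝ≥0∞) + 1) ^ 2 * g n := ENNReal.tsum_mul_left

lemma tsum_inv_sq_le {R : ℝ} (hR : 0 < R) :
    ∑' n : ℕ, ENNReal.ofReal (((n : ℝ) + 1 + R) ^ 2)⁻¹ ≤ ENNReal.ofReal R⁻¹ := by
  refine ENNReal.tsum_le_of_sum_range_le fun m => ?_
  rw [← ENNReal.ofReal_sum_of_nonneg fun _ _ => by positivity]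
  apply ENNReal.ofReal_le_ofReal
  suffices h : ∑ n ∈ Finset.range m, (((n : ℝ) + 1 + R) ^ 2)⁻¹ ≤ R⁻¹ - ((m : ℝ) + R)⁻¹ by
    have : 0 ≤ ((m : ℝ) + R)⁻¹ := by positivity
    linarith
  induction m with
  | zero => simp
  | succ m ih =>
    rw [Finset.sum_range_succ]
    have h : (((m : ℝ) + 1 + R) ^ 2)⁻¹ ≤ ((m : ℝ) + R)⁻¹ - ((m : ℝ) + 1 + R)⁻¹ := by
      have e : ((m : ℝ) + R)⁻¹ - ((m : ℝ) + 1 + R)⁻¹ = (((m : ℝ) + R) * ((m : ℝ) + 1 + R))⁻¹ := by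
        field_simp
        ring
      rw [e]
      apply inv_anti₀ (by positivity)
      nlinarith [(Nat.cast_nonneg m : (0 : ℝ) ≤ m)]
    push_cast
    linarith

/-- If `(n + 1)² g(n) ≤ K (n + 1 + R)⁻²`, then the radial sum of `g` over `ℤ³` is at most
`26 K / R`. -/
lemma tsum_radial_le_of_le {R K : ℝ} (hR : 0 < R) (hK : 0 ≤ K) (g : ℕ → ℝ)
    (h : ∀ n : ℕ, ((n : ℝ) + 1) ^ 2 * g n ≤ K * (((n : ℝ) + 1 + R) ^ 2)⁻¹) :
    ∑' x : Fin 3 → ℤ, ENNReal.ofReal (g (supNorm x)) ≤ ENNReal.ofReal (26 * (K * R⁻¹)) := by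
  refine (tsum_radial_le fun n => ENNReal.ofReal (g n)).trans ?_
  rw [ENNReal.ofReal_mul (by norm_num), ENNReal.ofReal_ofNat]
  gcongr
  calc ∑' n : ℕ, ((n : ℝ≥0∞) + 1) ^ 2 * ENNReal.ofReal (g n)
      ≤ ∑' n : ℕ, ENNReal.ofReal K * ENNReal.ofReal (((n : ℝ) + 1 + R) ^ 2)⁻¹ := by
        refine ENNReal.tsum_le_tsum fun n => ?_
        have e : ((n : ℝ≥0∞) + 1) ^ 2 = ENNReal.ofReal (((n : ℝ) + 1) ^ 2) := by
          rw [ENNReal.ofReal_pow (by positivity), ENNReal.ofReal_add (by positivity) zero_le_one]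
          simp
        rw [e, ← ENNReal.ofReal_mul (by positivity), ← ENNReal.ofReal_mul hK]
        exact ENNReal.ofReal_le_ofReal (h n)
    _ ≤ ENNReal.ofReal K * ENNReal.ofReal R⁻¹ := by
        rw [ENNReal.tsum_mul_left]
        gcongr
        exact tsum_inv_sq_le hR
    _ = ENNReal.ofReal (K * R⁻¹) := (ENNReal.ofReal_mul hK).symm

lemma tsum_inner_le {a : ℝ} (ha : 0 < a) :
    ∑' x : Fin 3 → ℤ, ENNReal.ofReal
      ((((supNorm x : ℝ) + 1) ^ 2 * ((supNorm x : ℝ) + 1 + a) ^ 2)⁻¹) ≤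
      ENNReal.ofReal (26 * a⁻¹) := by
  have := tsum_radial_le_of_le ha zero_le_one
    (fun n => (((n : ℝ) + 1) ^ 2 * ((n : ℝ) + 1 + a) ^ 2)⁻¹) fun n => by
      apply le_of_eq
      field_simp
  simpa only [one_mul] using this

lemma tsum_outer_le {R : ℝ} (hR : 0 < R) :
    ∑' x : Fin 3 → ℤ, ENNReal.ofReal ((((supNorm x : ℝ) + 1 + R) ^ 6)⁻¹) ≤
      ENNReal.ofReal (26 * ((R ^ 2)⁻¹ * R⁻¹)) := by
  refine tsum_radial_le_of_le hR (by positivity) (fun n => (((n : ℝ) + 1 + R) ^ 6)⁻¹) fun n => ?_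
  have hn : (0 : ℝ) ≤ n := Nat.cast_nonneg n
  have h1 : ((n : ℝ) + 1) ^ 2 ≤ ((n : ℝ) + 1 + R) ^ 2 :=
    pow_le_pow_left₀ (by positivity) (by linarith) 2
  have h2 : R ^ 2 ≤ ((n : ℝ) + 1 + R) ^ 2 :=
    pow_le_pow_left₀ hR.le (by linarith) 2
  rw [← mul_inv, ← div_eq_mul_inv, div_le_iff₀ (by positivity), ← div_eq_inv_mul,
    le_div_iff₀ (by positivity)]
  calc ((n : ℝ) + 1) ^ 2 * (R ^ 2 * ((n : ℝ) + 1 + R) ^ 2)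
      ≤ ((n : ℝ) + 1 + R) ^ 2 * (((n : ℝ) + 1 + R) ^ 2 * ((n : ℝ) + 1 + R) ^ 2) := by gcongr
    _ = ((n : ℝ) + 1 + R) ^ 6 := by ring

lemma inv_mul_le_add {a b R : ℝ} (hR : 0 < R) (ha : R ≤ a) (hb : R ≤ b) :
    (a ^ 4 * b ^ 2)⁻¹ ≤ 64 * (((a + R) ^ 6)⁻¹ + ((b + R) ^ 6)⁻¹) := by
  have key : ∀ t, R ≤ t → (t ^ 6)⁻¹ ≤ 64 * ((t + R) ^ 6)⁻¹ := by
    intro t ht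
    have ht0 : 0 < t := hR.trans_le ht
    rw [← div_eq_mul_inv, le_div_iff₀ (by positivity), ← div_eq_inv_mul,
      div_le_iff₀ (by positivity)]
    calc (t + R) ^ 6 ≤ (2 * t) ^ 6 := by gcongr; linarith
      _ = 64 * t ^ 6 := by ring
  have ha0 : 0 < a := hR.trans_le ha
  have hb0 : 0 < b := hR.trans_le hb
  have pa : 0 ≤ (a ^ 6)⁻¹ := by positivity
  have pb : 0 ≤ (b ^ 6)⁻¹ := by positivity
  have h : (a ^ 4 * b ^ 2)⁻¹ ≤ (a ^ 6)⁻¹ + (b ^ 6)⁻¹ := by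
    rcases le_total a b with hab | hab
    · have : (a ^ 4 * b ^ 2)⁻¹ ≤ (a ^ 6)⁻¹ := by
        apply inv_anti₀ (by positivity)
        calc a ^ 6 = a ^ 4 * a ^ 2 := by ring
          _ ≤ a ^ 4 * b ^ 2 := by gcongr
      linarith
    · have : (a ^ 4 * b ^ 2)⁻¹ ≤ (b ^ 6)⁻¹ := by
        apply inv_anti₀ (by positivity)
        calc b ^ 6 = b ^ 4 * b ^ 2 := by ring
          _ ≤ a ^ 4 * b ^ 2 := by gcongr
      linarith
  linarith [key a ha, key b hb]

/-- The summand is dominated by a product in which the two inner variables decouple. -/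
lemma summand_le (p x y z : Fin 3 → ℤ) :
    ((jap p * jap x * jap y * jap z * (jap x + jap (p + x)) * (jap y + jap (y - p))) ^ 2)⁻¹ ≤
      16 * ((((supNorm p : ℝ) + 1) ^ 2 * ((supNorm z : ℝ) + 1) ^ 2)⁻¹) *
        ((((supNorm x : ℝ) + 1) ^ 2 * ((supNorm x : ℝ) + 1 + ((supNorm p : ℝ) + 1)) ^ 2)⁻¹ *
          (((supNorm y : ℝ) + 1) ^ 2 * ((supNorm y : ℝ) + 1 + ((supNorm p : ℝ) + 1)) ^ 2)⁻¹) := by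
  have hp := supNorm_add_one_le_jap p
  have hx := supNorm_add_one_le_jap x
  have hy := supNorm_add_one_le_jap y
  have hz := supNorm_add_one_le_jap z
  have hpx := supNorm_add_one_le_jap (p + x)
  have hyp := supNorm_add_one_le_jap (y - p)
  have t1 : (supNorm p : ℝ) ≤ supNorm (p + x) + supNorm x := by
    have := supNorm_sub_le (p + x) x
    rw [add_sub_cancel_right] at this
    exact_mod_cast this
  have t2 : (supNorm p : ℝ) ≤ supNorm y + supNorm (y - p) := by
    have := supNorm_sub_le y (y - p)
    rw [sub_sub_cancel] at this
    exact_mod_cast this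
  have h1 : ((supNorm x : ℝ) + 1 + ((supNorm p : ℝ) + 1)) / 2 ≤ jap x + jap (p + x) := by
    linarith [(Nat.cast_nonneg _ : (0 : ℝ) ≤ supNorm (p + x))]
  have h2 : ((supNorm y : ℝ) + 1 + ((supNorm p : ℝ) + 1)) / 2 ≤ jap y + jap (y - p) := by
    linarith [(Nat.cast_nonneg _ : (0 : ℝ) ≤ supNorm (y - p))]
  calc ((jap p * jap x * jap y * jap z * (jap x + jap (p + x)) * (jap y + jap (y - p))) ^ 2)⁻¹
      ≤ ((((supNorm p : ℝ) + 1) * ((supNorm x : ℝ) + 1) * ((supNorm y : ℝ) + 1) *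
          ((supNorm z : ℝ) + 1) * (((supNorm x : ℝ) + 1 + ((supNorm p : ℝ) + 1)) / 2) *
          (((supNorm y : ℝ) + 1 + ((supNorm p : ℝ) + 1)) / 2)) ^ 2)⁻¹ := by
        have := (by positivity : (0 : ℝ) < (supNorm p : ℝ) + 1).trans_le hp
        have := (by positivity : (0 : ℝ) < (supNorm x : ℝ) + 1).trans_le hx
        have := (by positivity : (0 : ℝ) < (supNorm y : ℝ) + 1).trans_le hy
        have := (by positivity : (0 : ℝ) < (supNorm z : ℝ) + 1).trans_le hz
        have := (by positivity : (0 : ℝ) < (supNorm (p + x) : ℝ) + 1).trans_le hpx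
        apply inv_anti₀ (by positivity)
        gcongr
    _ = _ := by
        field_simp
        norm_num

/-- The sum over the two inner variables. -/
lemma tsum_pair_le (p z : Fin 3 → ℤ) :
    ∑' r : (Fin 3 → ℤ) × (Fin 3 → ℤ), ENNReal.ofReal
      ((jap p * jap r.1 * jap r.2 * jap z * (jap r.1 + jap (p + r.1)) *
        (jap r.2 + jap (r.2 - p))) ^ 2)⁻¹ ≤
      ENNReal.ofReal (10816 * (((supNorm p : ℝ) + 1) ^ 4 * ((supNorm z : ℝ) + 1) ^ 2)⁻¹) := by
  set a : ℝ := (supNorm p : ℝ) + 1 with ha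
  set b : ℝ := (supNorm z : ℝ) + 1 with hb
  have ha0 : 0 < a := by positivity
  have hb0 : 0 < b := by positivity
  set F : (Fin 3 → ℤ) → ℝ := fun x =>
    (((supNorm x : ℝ) + 1) ^ 2 * ((supNorm x : ℝ) + 1 + a) ^ 2)⁻¹ with hF
  have hF0 : ∀ x, 0 ≤ F x := fun x => by positivity
  have hs : ∑' x, ENNReal.ofReal (F x) ≤ ENNReal.ofReal (26 * a⁻¹) := tsum_inner_le ha0
  calc _ ≤ ∑' r : (Fin 3 → ℤ) × (Fin 3 → ℤ), ENNReal.ofReal (16 * (a ^ 2 * b ^ 2)⁻¹) *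
          (ENNReal.ofReal (F r.1) * ENNReal.ofReal (F r.2)) := by
        refine ENNReal.tsum_le_tsum fun r => ?_
        rw [← ENNReal.ofReal_mul (hF0 _), ← ENNReal.ofReal_mul (by positivity)]
        exact ENNReal.ofReal_le_ofReal (summand_le p r.1 r.2 z)
    _ = ENNReal.ofReal (16 * (a ^ 2 * b ^ 2)⁻¹) *
          ((∑' x, ENNReal.ofReal (F x)) * ∑' x, ENNReal.ofReal (F x)) := by
        rw [ENNReal.tsum_mul_left, ENNReal.tsum_prod']
        simp only [ENNReal.tsum_mul_left, ENNReal.tsum_mul_right]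
    _ ≤ ENNReal.ofReal (16 * (a ^ 2 * b ^ 2)⁻¹) *
          (ENNReal.ofReal (26 * a⁻¹) * ENNReal.ofReal (26 * a⁻¹)) := by gcongr
    _ = _ := by
        rw [← ENNReal.ofReal_mul (by positivity), ← ENNReal.ofReal_mul (by positivity)]
        congr 1
        field_simp
        norm_num

/-- The bound over the index set `E₂(ω)` of large frequencies in the estimate for the
second Wiener chaos component of the diagram ⟨22⟩: the sum ranges over
`ω₁, ω₂, ω₂' ∈ ℤ³` (with `ω₃ := ω - ω₁`) such that `|ω₁| ≥ c|ω|` and `|ω₃| ≥ c|ω|`. -/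
theorem sum_E2_bound (c : ℝ) (hc : c ∈ Set.Ioo (0 : ℝ) 1) :
    ∃ C : ℝ, ∀ ω : Fin 3 → ℤ,
      (∑' q : (Fin 3 → ℤ) × (Fin 3 → ℤ) × (Fin 3 → ℤ),
        if c * znorm ω ≤ znorm q.1 ∧ c * znorm ω ≤ znorm (ω - q.1) then
          ((jap q.1 * jap q.2.1 * jap q.2.2 * jap (ω - q.1) *
            (jap q.2.1 + jap (q.1 + q.2.1)) * (jap q.2.2 + jap (q.2.2 - q.1))) ^ 2)⁻¹
        else 0)
        ≤ C * (jap ω ^ 3)⁻¹ := by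
  have hc0 : 0 < c := hc.1
  refine ⟨2 * 64 * 10816 * 26 * (14 / c) ^ 3 * 14 ^ 3, fun ω => ?_⟩
  set R : ℝ := c / 14 * ((supNorm ω : ℝ) + 1) with hRdef
  have hR : 0 < R := by positivity
  have hlarge : ∀ y, c * znorm ω ≤ znorm y → R ≤ (supNorm y : ℝ) + 1 := by
    intro y hy
    have h1 := mul_jap_le hc hy
    have h2 := mul_le_mul_of_nonneg_left (supNorm_add_one_le_jap ω) hc0.le
    have h3 := jap_le y
    rw [hRdef, div_mul_eq_mul_div, div_le_iff₀ (by norm_num)]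
    linarith
  set f : (Fin 3 → ℤ) × (Fin 3 → ℤ) × (Fin 3 → ℤ) → ℝ := fun q =>
    if c * znorm ω ≤ znorm q.1 ∧ c * znorm ω ≤ znorm (ω - q.1) then
      ((jap q.1 * jap q.2.1 * jap q.2.2 * jap (ω - q.1) *
        (jap q.2.1 + jap (q.1 + q.2.1)) * (jap q.2.2 + jap (q.2.2 - q.1))) ^ 2)⁻¹
    else 0 with hf
  have hf0 : ∀ q, 0 ≤ f q := by
    intro q
    simp only [hf]
    split_ifs <;> positivity
  set E : (Fin 3 → ℤ) → ℝ := fun x => (((supNorm x : ℝ) + 1 + R) ^ 6)⁻¹ with hE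
  have hE0 : ∀ x, 0 ≤ E x := fun x => by positivity
  have houter : ∀ p, ∑' r, ENNReal.ofReal (f (p, r)) ≤
      ENNReal.ofReal (64 * 10816) * (ENNReal.ofReal (E p) + ENNReal.ofReal (E (ω - p))) := by
    intro p
    by_cases hp : c * znorm ω ≤ znorm p ∧ c * znorm ω ≤ znorm (ω - p)
    · simp only [hf, if_pos hp]
      refine (tsum_pair_le p (ω - p)).trans ?_
      rw [← ENNReal.ofReal_add (hE0 _) (hE0 _), ← ENNReal.ofReal_mul (by norm_num)]
      apply ENNReal.ofReal_le_ofReal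
      have := inv_mul_le_add hR (hlarge p hp.1) (hlarge _ hp.2)
      simp only [hE]
      linarith
    · simp [hf, if_neg hp]
  have htotal : ∑' q, ENNReal.ofReal (f q) ≤
      ENNReal.ofReal (2 * 64 * 10816 * 26 * ((R ^ 2)⁻¹ * R⁻¹)) := by
    have hs : ∑' x, ENNReal.ofReal (E x) ≤ ENNReal.ofReal (26 * ((R ^ 2)⁻¹ * R⁻¹)) :=
      tsum_outer_le hR
    calc ∑' q, ENNReal.ofReal (f q)
        = ∑' p, ∑' r, ENNReal.ofReal (f (p, r)) := ENNReal.tsum_prod'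
      _ ≤ ∑' p, ENNReal.ofReal (64 * 10816) *
            (ENNReal.ofReal (E p) + ENNReal.ofReal (E (ω - p))) := ENNReal.tsum_le_tsum houter
      _ = ENNReal.ofReal (64 * 10816) *
            (∑' x, ENNReal.ofReal (E x) + ∑' x, ENNReal.ofReal (E x)) := by
          rw [ENNReal.tsum_mul_left, ENNReal.tsum_add]
          congr 2
          exact (Equiv.subLeft ω).tsum_eq fun x => ENNReal.ofReal (E x)
      _ ≤ ENNReal.ofReal (64 * 10816) * (ENNReal.ofReal (26 * ((R ^ 2)⁻¹ * R⁻¹)) +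
            ENNReal.ofReal (26 * ((R ^ 2)⁻¹ * R⁻¹))) := by gcongr
      _ = _ := by
          rw [← ENNReal.ofReal_add (by positivity) (by positivity),
            ← ENNReal.ofReal_mul (by norm_num)]
          congr 1
          ring
  have hreal : ∑' q, f q ≤ 2 * 64 * 10816 * 26 * ((R ^ 2)⁻¹ * R⁻¹) := by
    have h := ENNReal.toReal_le_of_le_ofReal (by positivity) htotal
    rw [ENNReal.tsum_toReal_eq fun _ => ENNReal.ofReal_ne_top] at h
    simpa only [ENNReal.toReal_ofReal (hf0 _)] using h
  refine hreal.trans ?_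
  have hj : 0 < jap ω :=
    (by positivity : (0 : ℝ) < (supNorm ω : ℝ) + 1).trans_le (supNorm_add_one_le_jap ω)
  have hinv : (((supNorm ω : ℝ) + 1) ^ 3)⁻¹ ≤ 14 ^ 3 * (jap ω ^ 3)⁻¹ := by
    rw [← div_eq_mul_inv, le_div_iff₀ (by positivity), ← div_eq_inv_mul,
      div_le_iff₀ (by positivity), ← mul_pow]
    gcongr
    exact jap_le ω
  calc 2 * 64 * 10816 * 26 * ((R ^ 2)⁻¹ * R⁻¹)
      = 2 * 64 * 10816 * 26 * (14 / c) ^ 3 * (((supNorm ω : ℝ) + 1) ^ 3)⁻¹ := by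
        rw [hRdef]
        field_simp
    _ ≤ 2 * 64 * 10816 * 26 * (14 / c) ^ 3 * (14 ^ 3 * (jap ω ^ 3)⁻¹) := by gcongr
    _ = _ := by ring
end
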